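/- There exist constants C>0 and h_0>0, depending only on k, α, β, γ, b-a and the quasi-uniformity constant c, such that whenever h ≤ h_0, u is 2k-times continuously differentiable with u(a)=u(b)=0, f := -αu''+βu'+γu, and ū_h is a Gauss collocation solution, then |(u-ū_h)''(g_{in})| ≤ C h^{k} ‖u‖_{2k,∞} at each of the k-1 Gauss points g_{in} of every element τ_i (second derivatives of ū_h taken elementwise). -/

import Mathlib

open Set Finset intervalIntegral

/-- The Legendre polynomial of degree `n` (Rodrigues formula), as a real function. -/
noncomputable def legendre (n : ℕ) : ℝ → ℝ :=
  fun s => (1 / ((2 : ℝ) ^ n * n.factorial)) * iteratedDeriv n (fun t : ℝ => (t ^ 2 - 1) ^ n) s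

/-- The affine map sending `[-1,1]` onto `[p,q]`. -/
noncomputable def affMap (p q s : ℝ) : ℝ := (p + q) / 2 + s * (q - p) / 2

/-- `x 0 = a < x 1 < ... < x N = b` is a partition of `[a,b]`. -/
def IsMesh (a b : ℝ) (N : ℕ) (x : ℕ → ℝ) : Prop :=
  1 ≤ N ∧ x 0 = a ∧ x N = b ∧ ∀ i < N, x i < x (i + 1)

/-- `h` is the maximal element length `h = max_i (x i - x (i-1))`. -/
def IsMeshSize (N : ℕ) (x : ℕ → ℝ) (h : ℝ) : Prop :=
  (∀ i ∈ Finset.Icc 1 N, x i - x (i - 1) ≤ h) ∧ ∃ i ∈ Finset.Icc 1 N, x i - x (i - 1) = h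

/-- Quasi-uniformity with constant `c`: `h ≤ c · h_i` for all elements. -/
def IsQuasiUniform (N : ℕ) (x : ℕ → ℝ) (h c : ℝ) : Prop :=
  ∀ i ∈ Finset.Icc 1 N, h ≤ c * (x i - x (i - 1))

/-- `P i` are the element polynomials (degree ≤ k) of a member of `V_h^0`:
a C¹ piecewise polynomial vanishing at both ends of `[a,b]`. -/
def IsVh0 (k N : ℕ) (x : ℕ → ℝ) (P : ℕ → Polynomial ℝ) : Prop :=
  (∀ i ∈ Finset.Icc 1 N, (P i).natDegree ≤ k) ∧
  (∀ i ∈ Finset.Icc 1 (N - 1), (P i).eval (x i) = (P (i + 1)).eval (x i)) ∧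
  (∀ i ∈ Finset.Icc 1 (N - 1),
      (Polynomial.derivative (P i)).eval (x i) = (Polynomial.derivative (P (i + 1))).eval (x i)) ∧
  (P 1).eval (x 0) = 0 ∧ (P N).eval (x N) = 0

/-- `P i` are the element polynomials of a Petrov–Galerkin solution `u_h ∈ V_h^0`:
`∑_i ∫_{τ_i} (-α u_h'' + β u_h' + γ u_h) v_h = ∫_a^b f v_h` for all `v_h ∈ W_h`. -/
def IsPGSol (k N : ℕ) (x : ℕ → ℝ) (α β γ : ℝ) (f : ℝ → ℝ) (P : ℕ → Polynomial ℝ) : Prop :=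
  IsVh0 k N x P ∧
  ∀ Q : ℕ → Polynomial ℝ, (∀ i ∈ Finset.Icc 1 N, (Q i).natDegree ≤ k - 2) →
    (∑ i ∈ Finset.Icc 1 N, ∫ t in (x (i - 1))..(x i),
        (-α * ((Polynomial.derivative (Polynomial.derivative (P i))).eval t)
            + β * ((Polynomial.derivative (P i)).eval t) + γ * (P i).eval t) * (Q i).eval t)
      = ∑ i ∈ Finset.Icc 1 N, ∫ t in (x (i - 1))..(x i), f t * (Q i).eval t

/-- `P i` are the element polynomials of a Gauss collocation solution `ū_h ∈ V_h^0`: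
`(-α ū_h'' + β ū_h' + γ ū_h)(g) = f(g)` at every Gauss point `g` of every element. -/
def IsGaussSol (k N : ℕ) (x : ℕ → ℝ) (α β γ : ℝ) (f : ℝ → ℝ) (P : ℕ → Polynomial ℝ) : Prop :=
  IsVh0 k N x P ∧
  ∀ i ∈ Finset.Icc 1 N, ∀ s ∈ Set.Ioo (-1 : ℝ) 1, legendre (k - 1) s = 0 →
    -α * ((Polynomial.derivative (Polynomial.derivative (P i))).eval (affMap (x (i - 1)) (x i) s))
        + β * ((Polynomial.derivative (P i)).eval (affMap (x (i - 1)) (x i) s))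
        + γ * (P i).eval (affMap (x (i - 1)) (x i) s)
      = f (affMap (x (i - 1)) (x i) s)

/-- `p` is the elementwise truncated Jacobi projection of `u` on the element `[xl, xr]`:
the polynomial of degree ≤ k matching `u` and `u'` at both endpoints with
`(u - p)'' ⊥ P_{k-2}` in `L²(xl, xr)`. -/
def IsElemProj (k : ℕ) (u : ℝ → ℝ) (xl xr : ℝ) (p : Polynomial ℝ) : Prop :=
  p.natDegree ≤ k ∧ p.eval xl = u xl ∧ p.eval xr = u xr ∧
  (Polynomial.derivative p).eval xl = deriv u xl ∧
  (Polynomial.derivative p).eval xr = deriv u xr ∧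
  ∀ q : Polynomial ℝ, q.natDegree ≤ k - 2 →
    (∫ t in xl..xr,
        (iteratedDeriv 2 u t - (Polynomial.derivative (Polynomial.derivative p)).eval t)
          * q.eval t) = 0

open Polynomial in
theorem iteratedDeriv_polynomial_eval (n : ℕ) (p : ℝ[X]) :
    iteratedDeriv n (fun t => p.eval t) = fun t => (derivative^[n] p).eval t := by
  induction n with
  | zero => simp
  | succ n ih =>
    rw [iteratedDeriv_succ, ih, Function.iterate_succ_apply']
    ext t
    exact Polynomial.deriv _

/-- The unnormalised Legendre polynomial `(d/dX)^n (X² - 1)^n`. -/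
noncomputable def rodrigues (n : ℕ) : Polynomial ℝ :=
  Polynomial.derivative^[n] ((Polynomial.X ^ 2 - 1) ^ n)

open Polynomial in
theorem legendre_eq_zero_of_rodrigues (n : ℕ) (s : ℝ) (h : (rodrigues n).eval s = 0) :
    legendre n s = 0 := by
  have := iteratedDeriv_polynomial_eval n ((X ^ 2 - 1) ^ n)
  simp only [eval_pow, eval_sub, eval_X, eval_one] at this
  unfold legendre
  rw [this]
  simp only [rodrigues] at h
  simp [h]

open Polynomial in
theorem eval_iterate_derivative_of_sq_eq_one {n j : ℕ} (hj : j < n) {s : ℝ} (hs : s ^ 2 = 1) :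
    (derivative^[j] ((X ^ 2 - 1 : ℝ[X]) ^ n)).eval s = 0 := by
  have h := pow_sub_dvd_iterate_derivative_of_pow_dvd j (dvd_refl ((X ^ 2 - 1 : ℝ[X]) ^ n))
  have h1 : (X ^ 2 - 1 : ℝ[X]) ∣ derivative^[j] ((X ^ 2 - 1 : ℝ[X]) ^ n) :=
    (dvd_pow_self _ (by omega)).trans h
  obtain ⟨q, hq⟩ := h1
  rw [hq]
  simp [hs]

open Polynomial in
theorem exists_rodrigues_intermediate_zeros (n j : ℕ) (hj : j < n) :
    ∃ z : ℕ → ℝ, z 0 = -1 ∧ z (j + 1) = 1 ∧ (∀ i ≤ j, z i < z (i + 1)) ∧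
      ∀ i ≤ j + 1, (derivative^[j] ((X ^ 2 - 1 : ℝ[X]) ^ n)).eval (z i) = 0 := by
  induction j with
  | zero =>
    refine ⟨fun i => if i = 0 then -1 else 1, by simp, by simp, ?_, ?_⟩
    · intro i hi
      obtain rfl : i = 0 := by omega
      norm_num
    · intro i _
      apply eval_iterate_derivative_of_sq_eq_one hj
      dsimp only
      split_ifs <;> norm_num
  | succ j ih =>
    obtain ⟨z, h0, h1, hm, hz⟩ := ih (by omega)
    have hr : ∀ i, ∃ y, i ≤ j → (z i < y ∧ y < z (i + 1)) ∧
        (derivative^[j + 1] ((X ^ 2 - 1 : ℝ[X]) ^ n)).eval y = 0 := by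
      intro i
      by_cases hi : i ≤ j
      · obtain ⟨y, hy, hy0⟩ := exists_hasDerivAt_eq_zero (hm i hi)
          (derivative^[j] ((X ^ 2 - 1 : ℝ[X]) ^ n)).continuous.continuousOn
          (by rw [hz i (by omega), hz (i + 1) (by omega)])
          (fun x _ => (derivative^[j] ((X ^ 2 - 1 : ℝ[X]) ^ n)).hasDerivAt x)
        exact ⟨y, fun _ => ⟨hy, by rwa [Function.iterate_succ_apply']⟩⟩
      · exact ⟨0, fun h => absurd h hi⟩
    choose y hy using hr
    refine ⟨fun i => if i = 0 then -1 else if i = j + 2 then 1 else y (i - 1), by simp, by simp,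
      ?_, ?_⟩
    · intro i hi
      rcases Nat.eq_zero_or_pos i with rfl | hpos
      · have := (hy 0 (by omega)).1.1
        simpa [h0] using this
      · obtain ⟨m, rfl⟩ : ∃ m, i = m + 1 := ⟨i - 1, by omega⟩
        have hm1 := (hy m (by omega)).1.2
        by_cases hmj : m = j
        · subst hmj
          simp
          linarith
        · have := (hy (m + 1) (by omega)).1.1
          simp [hmj, show m ≠ j + 1 by omega]
          linarith
    · intro i hi
      dsimp only
      split_ifs with hi0 hi1
      · exact eval_iterate_derivative_of_sq_eq_one hj (by norm_num)
      · exact eval_iterate_derivative_of_sq_eq_one hj (by norm_num)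
      · exact (hy (i - 1) (by omega)).2

open Polynomial in
theorem exists_rodrigues_zeros (n : ℕ) (hn : 1 ≤ n) :
    ∃ G : Finset ℝ, G.card = n ∧ ∀ s ∈ G, s ∈ Set.Ioo (-1 : ℝ) 1 ∧ (rodrigues n).eval s = 0 := by
  obtain ⟨m, rfl⟩ : ∃ m, n = m + 1 := ⟨n - 1, by omega⟩
  obtain ⟨z, h0, h1, hm, hz⟩ := exists_rodrigues_intermediate_zeros (m + 1) m (by omega)
  have hr : ∀ i : Fin (m + 1), ∃ y, (z i < y ∧ y < z (i + 1)) ∧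
      (rodrigues (m + 1)).eval y = 0 := by
    intro i
    obtain ⟨y, hy, hy0⟩ := exists_hasDerivAt_eq_zero (hm i (by omega))
      (derivative^[m] ((X ^ 2 - 1 : ℝ[X]) ^ (m + 1))).continuous.continuousOn
      (by rw [hz i (by omega), hz (i + 1) (by omega)])
      (fun x _ => (derivative^[m] ((X ^ 2 - 1 : ℝ[X]) ^ (m + 1))).hasDerivAt x)
    exact ⟨y, hy, by rwa [rodrigues, Function.iterate_succ_apply']⟩
  choose y hy using hr
  have hmono : ∀ i j, i ≤ j → j ≤ m + 1 → z i ≤ z j := by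
    intro i j hij
    induction j, hij using Nat.le_induction with
    | base => simp
    | succ j hij ih => exact fun hj => (ih (by omega)).trans (hm j (by omega)).le
  have hy_strict : StrictMono y := by
    intro i j hij
    have := hmono (i + 1) j (by exact_mod_cast hij) (by omega)
    linarith [(hy i).1.2, (hy j).1.1]
  refine ⟨Finset.univ.image y, ?_, ?_⟩
  · rw [Finset.card_image_of_injective _ hy_strict.injective]
    simp
  · intro s hs
    obtain ⟨i, -, rfl⟩ := Finset.mem_image.1 hs
    have ha := hmono 0 i (by omega) (by omega)
    have hb := hmono (i + 1) (m + 1) (by omega) le_rfl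
    refine ⟨⟨?_, ?_⟩, (hy i).2⟩
    · linarith [(hy i).1.1]
    · linarith [(hy i).1.2]

open Polynomial in
theorem natDegree_rodrigues_le (n : ℕ) : (rodrigues n).natDegree ≤ n := by
  have h1 := natDegree_iterate_derivative ((X ^ 2 - 1 : ℝ[X]) ^ n) n
  have h2 : ((X ^ 2 - 1 : ℝ[X]) ^ n).natDegree = n * 2 := by
    rw [natDegree_pow, show (X ^ 2 - 1 : ℝ[X]) = X ^ 2 - C 1 by simp, natDegree_X_pow_sub_C]
  simp only [rodrigues]
  omega

open Polynomial in
theorem coeff_rodrigues_ne_zero (n : ℕ) : (rodrigues n).coeff n ≠ 0 := by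
  have hm : ((X ^ 2 - 1 : ℝ[X]) ^ n).Monic := by
    apply Monic.pow
    simpa using monic_X_pow_sub_C (1 : ℝ) (two_ne_zero)
  have h2 : ((X ^ 2 - 1 : ℝ[X]) ^ n).natDegree = n * 2 := by
    rw [natDegree_pow, show (X ^ 2 - 1 : ℝ[X]) = X ^ 2 - C 1 by simp, natDegree_X_pow_sub_C]
  rw [rodrigues, coeff_iterate_derivative, show n + n = ((X ^ 2 - 1 : ℝ[X]) ^ n).natDegree by omega,
    hm.coeff_natDegree, h2]
  simp [Nat.descFactorial_eq_zero_iff_lt]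
  omega

open Polynomial in
theorem integral_rodrigues (n : ℕ) (hn : 1 ≤ n) :
    ∫ t in (-1 : ℝ)..1, (rodrigues n).eval t = 0 := by
  obtain ⟨m, rfl⟩ : ∃ m, n = m + 1 := ⟨n - 1, by omega⟩
  have h := intervalIntegral.integral_eq_sub_of_hasDerivAt (a := -1) (b := 1)
    (fun x _ => (derivative^[m] ((X ^ 2 - 1 : ℝ[X]) ^ (m + 1))).hasDerivAt x)
    (Polynomial.continuous _).continuousOn.intervalIntegrable
  rw [eval_iterate_derivative_of_sq_eq_one (by omega) (by norm_num),
    eval_iterate_derivative_of_sq_eq_one (by omega) (by norm_num)] at h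
  rw [rodrigues, Function.iterate_succ_apply']
  simpa using h

open Polynomial in
/-- Stability of interpolation and quadrature at the Gauss points of the reference element. -/
theorem exists_reference_gauss_bound (n : ℕ) (hn : 1 ≤ n) :
    ∃ K > 0, ∀ (q : ℝ[X]) (ε : ℝ), 0 ≤ ε →
      (∀ s ∈ Set.Ioo (-1 : ℝ) 1, legendre n s = 0 → |q.eval s| ≤ ε) →
      (q.natDegree < n → ∀ t ∈ Set.Icc (-1 : ℝ) 1, |q.eval t| ≤ K * ε) ∧
      (q.natDegree ≤ n → |∫ t in (-1 : ℝ)..1, q.eval t| ≤ 2 * K * ε) := by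
  obtain ⟨G, hcard, hG⟩ := exists_rodrigues_zeros n hn
  have hb : ∀ g : ℝ, ∃ Kg : ℝ, 0 ≤ Kg ∧ ∀ t ∈ Set.Icc (-1 : ℝ) 1,
      |(Lagrange.basis G id g).eval t| ≤ Kg := by
    intro g
    obtain ⟨Kg, h⟩ := (isCompact_Icc (a := (-1 : ℝ)) (b := 1)).exists_bound_of_continuousOn
      (Lagrange.basis G id g).continuous.continuousOn
    exact ⟨Kg, (norm_nonneg _).trans (h 0 (by norm_num)), h⟩
  choose Kg hKg0 hKg using hb
  have key : ∀ (q : ℝ[X]) (ε : ℝ), 0 ≤ ε → (∀ s ∈ G, |q.eval s| ≤ ε) → q.natDegree < n →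
      ∀ t ∈ Set.Icc (-1 : ℝ) 1, |q.eval t| ≤ (∑ g ∈ G, Kg g + 1) * ε := by
    intro q ε hε hq hdeg t ht
    have hdeg' : q.degree < G.card := by
      rw [hcard]
      exact degree_le_natDegree.trans_lt (by exact_mod_cast hdeg)
    have he := Lagrange.eq_interpolate (v := id) (Function.injective_id.injOn) hdeg'
    rw [he, Lagrange.interpolate_apply, eval_finsetSum]
    calc _ ≤ ∑ g ∈ G, |(C (eval (id g) q) * Lagrange.basis G id g).eval t| :=
          Finset.abs_sum_le_sum_abs _ _
      _ ≤ ∑ g ∈ G, Kg g * ε := by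
          apply Finset.sum_le_sum
          intro g hg
          rw [eval_mul, eval_C, abs_mul, mul_comm]
          exact mul_le_mul (hKg g t ht) (hq g hg) (abs_nonneg _) (hKg0 g)
      _ ≤ _ := by rw [← Finset.sum_mul]; nlinarith
  have hKpos : 0 < ∑ g ∈ G, Kg g + 1 := by
    have := Finset.sum_nonneg (s := G) (fun g _ => hKg0 g)
    linarith
  refine ⟨_, hKpos, fun q ε hε hq => ?_⟩
  have hqG : ∀ s ∈ G, |q.eval s| ≤ ε := fun s hs =>
    hq s (hG s hs).1 (legendre_eq_zero_of_rodrigues n s (hG s hs).2)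
  refine ⟨key q ε hε hqG, fun hdeg => ?_⟩
  set r := q - C (q.coeff n / (rodrigues n).coeff n) * rodrigues n with hr
  have hrdeg : r.natDegree < n := by
    have hle : r.natDegree ≤ n := (natDegree_sub_le_of_le hdeg
      ((natDegree_C_mul_le _ _).trans (natDegree_rodrigues_le n))).trans (max_self n).le
    have hc : r.coeff n = 0 := by
      simp [hr, div_mul_cancel₀ _ (coeff_rodrigues_ne_zero n)]
    rcases hle.lt_or_eq with h | h
    · exact h
    · have : r.leadingCoeff = 0 := by rw [leadingCoeff, h, hc]
      rw [leadingCoeff_eq_zero] at this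
      rw [this] at h
      simp at h
      omega
  have hrG : ∀ s ∈ G, |r.eval s| ≤ ε := fun s hs => by
    simpa [hr, (hG s hs).2] using hqG s hs
  have hint : ∫ t in (-1 : ℝ)..1, q.eval t = ∫ t in (-1 : ℝ)..1, r.eval t := by
    have hrw : ∀ t, r.eval t
        = q.eval t - (q.coeff n / (rodrigues n).coeff n) * (rodrigues n).eval t := by
      intro t; simp [hr]
    simp_rw [hrw]
    rw [intervalIntegral.integral_sub (q.continuous.intervalIntegrable _ _)
      (((rodrigues n).continuous.const_mul _).intervalIntegrable _ _),
      intervalIntegral.integral_const_mul, integral_rodrigues n hn]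
    simp
  rw [hint]
  have := intervalIntegral.norm_integral_le_of_norm_le_const (a := -1) (b := 1)
    (f := fun t => r.eval t) (C := (∑ g ∈ G, Kg g + 1) * ε) (fun t ht => by
      rw [Set.uIoc_of_le (by norm_num)] at ht
      exact key r ε hε hrG hrdeg t ⟨ht.1.le, ht.2⟩)
  rw [Real.norm_eq_abs] at this
  norm_num at this
  linarith

open Polynomial in
/-- Stability of interpolation and quadrature at the Gauss points of an arbitrary element. -/
theorem exists_gauss_bound (n : ℕ) (hn : 1 ≤ n) :
    ∃ K > 0, ∀ (p r : ℝ), p < r → ∀ (q : ℝ[X]) (ε : ℝ), 0 ≤ ε →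
      (∀ s ∈ Set.Ioo (-1 : ℝ) 1, legendre n s = 0 → |q.eval (affMap p r s)| ≤ ε) →
      (q.natDegree < n → ∀ t ∈ Set.Icc p r, |q.eval t| ≤ K * ε) ∧
      (q.natDegree ≤ n → |∫ t in p..r, q.eval t| ≤ K * (r - p) * ε) := by
  obtain ⟨K, hK, h⟩ := exists_reference_gauss_bound n hn
  refine ⟨K, hK, fun p r hpr q ε hε hq => ?_⟩
  set q' := q.comp (C ((r - p) / 2) * X + C ((p + r) / 2)) with hq'
  have heval : ∀ s, q'.eval s = q.eval ((r - p) / 2 * s + (p + r) / 2) := by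
    intro s; simp [hq']
  have hdeg : q'.natDegree ≤ q.natDegree := by
    rw [hq', natDegree_comp]
    exact (Nat.mul_le_mul_left _ (natDegree_linear_le)).trans (by simp)
  obtain ⟨h1, h2⟩ := h q' ε hε (fun s hs hs0 => by
    rw [heval]
    convert hq s hs hs0 using 3
    rw [affMap]; ring)
  refine ⟨fun hd t ht => ?_, fun hd => ?_⟩
  · have hpr' : (0 : ℝ) < r - p := by linarith
    have := h1 (by omega) ((2 * t - (p + r)) / (r - p))
      ⟨by rw [le_div_iff₀ hpr']; linarith [ht.1], by rw [div_le_iff₀ hpr']; linarith [ht.2]⟩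
    rw [heval] at this
    convert this using 3
    field_simp
    ring
  · have := h2 (by omega)
    simp_rw [heval] at this
    have he := intervalIntegral.mul_integral_comp_mul_add (a := -1) (b := 1)
      (f := fun t => q.eval t) ((r - p) / 2) ((p + r) / 2)
    rw [show (r - p) / 2 * -1 + (p + r) / 2 = p by ring,
      show (r - p) / 2 * 1 + (p + r) / 2 = r by ring] at he
    rw [← he, abs_mul, abs_of_pos (by linarith : 0 < (r - p) / 2)]
    nlinarith

theorem mesh_monotone {x : ℕ → ℝ} {N : ℕ} (hx : ∀ i < N, x i < x (i + 1)) {i j : ℕ} (hij : i ≤ j)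
    (hj : j ≤ N) : x i ≤ x j := by
  induction j, hij using Nat.le_induction with
  | base => exact le_rfl
  | succ j _ ih => exact (ih (by omega)).trans (hx j (by omega)).le

/-- Gluing of `C¹` pieces with matching values and derivatives at the nodes of a mesh. -/
theorem exists_glued_of_matching (x : ℕ → ℝ) (f f' : ℕ → ℝ → ℝ) (N : ℕ) (hN : 1 ≤ N)
    (hx : ∀ i < N, x i < x (i + 1))
    (hf : ∀ i ∈ Finset.Icc 1 N, ∀ t, HasDerivAt (f i) (f' i t) t)
    (hf' : ∀ i ∈ Finset.Icc 1 N, Continuous (f' i))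
    (hm : ∀ i ∈ Finset.Icc 1 (N - 1), f i (x i) = f (i + 1) (x i))
    (hm' : ∀ i ∈ Finset.Icc 1 (N - 1), f' i (x i) = f' (i + 1) (x i)) :
    ∃ v v' : ℝ → ℝ, (∀ t, HasDerivAt v (v' t) t) ∧ Continuous v' ∧
      (∀ i ∈ Finset.Icc 1 N, ∀ t ∈ Set.Icc (x (i - 1)) (x i), v t = f i t ∧ v' t = f' i t) ∧
      ∀ t, x (N - 1) ≤ t → v t = f N t ∧ v' t = f' N t := by
  induction N, hN using Nat.le_induction with
  | base =>
    refine ⟨f 1, f' 1, hf 1 (by simp), hf' 1 (by simp), ?_, fun t _ => ⟨rfl, rfl⟩⟩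
    intro i hi t _
    obtain rfl : i = 1 := by simpa using hi
    exact ⟨rfl, rfl⟩
  | succ N hN ih =>
    have hsub : ∀ {i}, i ∈ Finset.Icc 1 N → i ∈ Finset.Icc 1 (N + 1) := fun hi => by
      rw [Finset.mem_Icc] at hi ⊢; omega
    have hsub' : ∀ {i}, i ∈ Finset.Icc 1 (N - 1) → i ∈ Finset.Icc 1 (N + 1 - 1) := fun hi => by
      rw [Finset.mem_Icc] at hi ⊢; omega
    obtain ⟨v, v', hv, hvc, hvf, hvN⟩ := ih (fun i hi => hx i (by omega))
      (fun i hi => hf i (hsub hi)) (fun i hi => hf' i (hsub hi))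
      (fun i hi => hm i (hsub' hi)) (fun i hi => hm' i (hsub' hi))
    have hlast : N + 1 ∈ Finset.Icc 1 (N + 1) := by simp
    have hNmem : N ∈ Finset.Icc 1 (N + 1 - 1) := by simp [hN]
    have hxN : x (N - 1) ≤ x N := by
      have := hx (N - 1) (by omega)
      rw [Nat.sub_add_cancel hN] at this
      exact this.le
    have hj : v (x N) = f (N + 1) (x N) := by rw [(hvN _ hxN).1, hm N hNmem]
    have hj' : v' (x N) = f' (N + 1) (x N) := by rw [(hvN _ hxN).2, hm' N hNmem]
    refine ⟨fun t => if t ≤ x N then v t else f (N + 1) t,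
      fun t => if t ≤ x N then v' t else f' (N + 1) t, ?_, ?_, ?_, ?_⟩
    · intro t
      rcases lt_trichotomy t (x N) with h | h | h
      · simp only [h.le, if_true]
        refine (hv t).congr_of_eventuallyEq ?_
        filter_upwards [Iio_mem_nhds h] with s hs
        rw [if_pos (Set.mem_Iio.1 hs).le]
      · have hl : HasDerivWithinAt (fun t => if t ≤ x N then v t else f (N + 1) t) (v' t)
            (Set.Iic t) t := by
          refine (hv t).hasDerivWithinAt.congr (fun s hs => ?_) ?_
          · simp [(Set.mem_Iic.1 hs).trans h.le]
          · simp [h.le]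
        have hr : HasDerivWithinAt (fun t => if t ≤ x N then v t else f (N + 1) t) (v' t)
            (Set.Ici t) t := by
          have := (hf (N + 1) hlast t).hasDerivWithinAt (s := Set.Ici t)
          rw [h, ← hj', ← h] at this
          refine this.congr (fun s hs => ?_) ?_
          · rcases (Set.mem_Ici.1 hs).lt_or_eq with h2 | h2
            · simp [not_le.2 (h ▸ h2)]
            · rw [← h2, h]; simp [hj]
          · rw [h]; simp [hj]
        have := hl.union hr
        rw [Set.Iic_union_Ici, hasDerivWithinAt_univ] at this
        simpa only [h.le, if_true] using this
      · simp only [not_le.2 h, if_false]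
        refine (hf (N + 1) hlast t).congr_of_eventuallyEq ?_
        filter_upwards [Ioi_mem_nhds h] with s hs
        rw [if_neg (not_le.2 (Set.mem_Ioi.1 hs))]
    · exact Continuous.if_le hvc (hf' (N + 1) hlast) continuous_id continuous_const
        (fun t ht => by
          have ht' : t = x N := ht
          rw [ht', hj'])
    · intro i hi t ht
      have hglue : ∀ t, x N ≤ t → (if t ≤ x N then v t else f (N + 1) t) = f (N + 1) t ∧
          (if t ≤ x N then v' t else f' (N + 1) t) = f' (N + 1) t := by
        intro t ht
        rcases ht.lt_or_eq with h | h
        · simp [not_le.2 h]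
        · rw [← h]; simp [hj, hj']
      by_cases hiN : i = N + 1
      · subst hiN
        exact hglue t (by simpa using ht.1)
      · have hiN' : i ∈ Finset.Icc 1 N := by
          rw [Finset.mem_Icc] at hi ⊢; omega
        have hmono : x i ≤ x N :=
          mesh_monotone hx (Finset.mem_Icc.1 hiN').2 (Nat.le_succ N)
        simpa [ht.2.trans hmono] using hvf i hiN' t ht
    · intro t ht
      simp only [Nat.add_sub_cancel] at ht
      rcases ht.lt_or_eq with h | h
      · simp [not_le.2 h]
      · rw [← h]; simp [hj', hj]

/-- Energy estimate for the two-point boundary value problem with data in divergence form. -/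
theorem abs_le_of_flux_bound {α β γ a b η : ℝ} (hα : 0 < α) (hγ : 0 ≤ γ) (hab : a < b)
    (hη : 0 < η) {v v' : ℝ → ℝ} (hv : ∀ t, HasDerivAt v (v' t) t) (hv' : Continuous v')
    (ha : v a = 0) (hb : v b = 0)
    (hS : ∀ t ∈ Set.Icc a b,
      |β * v t + γ * (∫ y in a..t, v y) - α * v' t + α * v' a| ≤ η) :
    ∀ t ∈ Set.Icc a b, |v t| ≤ (b - a) / α * η ∧
      |v' t| ≤ 2 / α * ((|β| + γ * (b - a)) * ((b - a) / α) + 1) * η := by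
  have hvc : Continuous v := continuous_iff_continuousAt.2 fun t => (hv t).continuousAt
  set V : ℝ → ℝ := fun t => ∫ y in a..t, v y with hV
  have hVd : ∀ t, HasDerivAt V (v t) t := fun t =>
    intervalIntegral.integral_hasDerivAt_right (hvc.intervalIntegrable _ _)
      (hvc.stronglyMeasurableAtFilter _ _) hvc.continuousAt
  have hVc : Continuous V := continuous_iff_continuousAt.2 fun t => (hVd t).continuousAt
  set S : ℝ → ℝ := fun t => β * v t + γ * V t - α * v' t + α * v' a with hSdef
  have hSc : Continuous S := by fun_prop
  have hener : ∫ t in a..b, (S t * v' t + α * v' t ^ 2 + γ * v t ^ 2) = 0 := by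
    have := intervalIntegral.integral_eq_sub_of_hasDerivAt (a := a) (b := b)
      (f := fun t => β / 2 * (v t * v t) + γ * (V t * v t) + α * v' a * v t)
      (f' := fun t => S t * v' t + α * v' t ^ 2 + γ * v t ^ 2)
      (fun t _ => by
        have h1 := (((hv t).mul (hv t)).const_mul (β / 2)).add
          (((hVd t).mul (hv t)).const_mul γ)
        have h2 := h1.add ((hv t).const_mul (α * v' a))
        refine h2.congr_deriv ?_
        simp only [hSdef]
        ring)
      ((by fun_prop : Continuous _).intervalIntegrable _ _)
    rw [this]
    simp [ha, hb]
  have hpt : ∀ t ∈ Set.Icc a b,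
      |v' t| ≤ (1 / η) * (S t * v' t + α * v' t ^ 2 + γ * v t ^ 2) + η / α := by
    intro t ht
    have h1 : -(η * |v' t|) ≤ S t * v' t := by
      have : |S t * v' t| ≤ η * |v' t| := by
        rw [abs_mul]; exact mul_le_mul_of_nonneg_right (hS t ht) (abs_nonneg _)
      linarith [neg_abs_le (S t * v' t)]
    have h2 : 0 ≤ γ * v t ^ 2 := by positivity
    have h3 : 2 * η * |v' t| ≤ α * v' t ^ 2 + η ^ 2 / α := by
      have : 0 ≤ (α * |v' t| - η) ^ 2 / α := by positivity
      have h4 : (α * |v' t| - η) ^ 2 / α = α * v' t ^ 2 - 2 * η * |v' t| + η ^ 2 / α := by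
        rw [← sq_abs (v' t)]; field_simp; ring
      linarith
    have h5 : η * |v' t| ≤ (S t * v' t + α * v' t ^ 2 + γ * v t ^ 2) + η ^ 2 / α := by linarith
    calc |v' t| = (1 / η) * (η * |v' t|) := by field_simp
      _ ≤ (1 / η) * ((S t * v' t + α * v' t ^ 2 + γ * v t ^ 2) + η ^ 2 / α) := by gcongr
      _ = _ := by field_simp
  have htot : ∫ t in a..b, |v' t| ≤ (b - a) / α * η := by
    calc ∫ t in a..b, |v' t|
        ≤ ∫ t in a..b, ((1 / η) * (S t * v' t + α * v' t ^ 2 + γ * v t ^ 2) + η / α) :=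
          intervalIntegral.integral_mono_on hab.le (hv'.abs.intervalIntegrable _ _)
            ((by fun_prop : Continuous _).intervalIntegrable _ _) hpt
      _ = (b - a) / α * η := by
          rw [intervalIntegral.integral_add ((by fun_prop : Continuous _).intervalIntegrable _ _)
            ((by fun_prop : Continuous _).intervalIntegrable _ _),
            intervalIntegral.integral_const_mul, hener]
          simp
          ring
  have hvb : ∀ t ∈ Set.Icc a b, |v t| ≤ (b - a) / α * η := by
    intro t ht
    have h1 := intervalIntegral.integral_eq_sub_of_hasDerivAt (a := a) (b := t)
      (fun s _ => hv s) (hv'.intervalIntegrable _ _)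
    rw [ha, sub_zero] at h1
    rw [← h1]
    calc _ ≤ ∫ s in a..t, |v' s| := intervalIntegral.abs_integral_le_integral_abs ht.1
      _ ≤ ∫ s in a..b, |v' s| := by
          rw [← intervalIntegral.integral_add_adjacent_intervals
            (hv'.abs.intervalIntegrable a t) (hv'.abs.intervalIntegrable t b)]
          have := intervalIntegral.integral_nonneg ht.2 (f := fun s => |v' s|) (μ := MeasureTheory.volume)
            (fun s _ => abs_nonneg _)
          linarith
      _ ≤ _ := htot
  set X := (b - a) / α * η with hX
  have hX0 : 0 ≤ X := by
    have : 0 < b - a := by linarith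
    positivity
  have hVb : ∀ t ∈ Set.Icc a b, |V t| ≤ (b - a) * X := by
    intro t ht
    have := intervalIntegral.norm_integral_le_of_norm_le_const (a := a) (b := t) (f := v) (C := X)
      (fun s hs => by
        rw [Set.uIoc_of_le ht.1] at hs
        exact hvb s ⟨hs.1.le, hs.2.trans ht.2⟩)
    rw [Real.norm_eq_abs, abs_of_nonneg (by linarith [ht.1] : 0 ≤ t - a)] at this
    refine this.trans ?_
    nlinarith [ht.2]
  obtain ⟨t₀, ht₀, hv0⟩ := exists_hasDerivAt_eq_zero hab hvc.continuousOn (by rw [ha, hb])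
    (fun t _ => hv t)
  have hA : ∀ t ∈ Set.Icc a b, |β * v t + γ * V t - S t| ≤ |β| * X + γ * ((b - a) * X) + η := by
    intro t ht
    calc _ ≤ |β * v t + γ * V t| + |S t| := abs_sub _ _
      _ ≤ |β * v t| + |γ * V t| + |S t| := by gcongr; exact abs_add_le _ _
      _ ≤ _ := by
          rw [abs_mul, abs_mul, abs_of_nonneg hγ]
          gcongr
          · exact hvb t ht
          · exact hVb t ht
          · exact hS t ht
  intro t ht
  refine ⟨hvb t ht, ?_⟩
  have h1 : α * v' t = (β * v t + γ * V t - S t) - (β * v t₀ + γ * V t₀ - S t₀) := by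
    simp only [hSdef, hv0]; ring
  have h2 : α * |v' t| ≤ 2 * (|β| * X + γ * ((b - a) * X) + η) := by
    rw [show α * |v' t| = |α * v' t| by rw [abs_mul, abs_of_pos hα], h1]
    refine (abs_sub _ _).trans ?_
    linarith [hA t ht, hA t₀ ⟨ht₀.1.le, ht₀.2.le⟩]
  calc |v' t| = (α * |v' t|) / α := by field_simp
    _ ≤ 2 * (|β| * X + γ * ((b - a) * X) + η) / α := by gcongr
    _ = _ := by rw [hX]; ring

/-- The energy estimate `abs_le_of_flux_bound` with a possibly vanishing flux bound. -/
theorem abs_le_of_flux_bound_nonneg {α β γ a b η : ℝ} (hα : 0 < α) (hγ : 0 ≤ γ) (hab : a < b)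
    (hη : 0 ≤ η) {v v' : ℝ → ℝ} (hv : ∀ t, HasDerivAt v (v' t) t) (hv' : Continuous v')
    (ha : v a = 0) (hb : v b = 0)
    (hS : ∀ t ∈ Set.Icc a b,
      |β * v t + γ * (∫ y in a..t, v y) - α * v' t + α * v' a| ≤ η) :
    ∀ t ∈ Set.Icc a b, |v t| ≤ (b - a) / α * η ∧
      |v' t| ≤ 2 / α * ((|β| + γ * (b - a)) * ((b - a) / α) + 1) * η := by
  intro t ht
  have hba : 0 < b - a := by linarith
  have h := fun (ε : ℝ) (hε : 0 < ε) => abs_le_of_flux_bound (η := η + ε) hα hγ hab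
    (by linarith) hv hv' ha hb (fun t ht => (hS t ht).trans (by linarith)) t ht
  have hlim : ∀ (y K : ℝ), 0 < K → (∀ ε > 0, y ≤ K * (η + ε)) → y ≤ K * η := by
    intro y K hK hy
    refine le_of_forall_pos_le_add fun ε hε => (hy (ε / K) (by positivity)).trans (le_of_eq ?_)
    field_simp
  exact ⟨hlim _ _ (by positivity) fun ε hε => (h ε hε).1,
    hlim _ _ (by positivity) fun ε hε => (h ε hε).2⟩

open Polynomial in
theorem exists_polynomial_approx {f : ℝ → ℝ} (m : ℕ) (hf : ContDiff ℝ (m + 1) f) {p r M : ℝ}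
    (hpr : p < r) (hM : ∀ t ∈ Set.Icc p r, |iteratedDeriv (m + 1) f t| ≤ M) :
    ∃ T : ℝ[X], T.natDegree ≤ m ∧ ∀ t ∈ Set.Icc p r, |f t - T.eval t| ≤ M * (r - p) ^ (m + 1) := by
  refine ⟨∑ j ∈ Finset.range (m + 1),
    C ((j.factorial : ℝ)⁻¹ * iteratedDerivWithin j f (Set.Icc p r) p) * (X - C p) ^ j, ?_, ?_⟩
  · refine natDegree_sum_le_of_forall_le _ _ fun j hj => ?_
    refine (natDegree_C_mul_le _ _).trans ?_
    rw [natDegree_pow, natDegree_X_sub_C]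
    have := Finset.mem_range.1 hj
    omega
  · intro t ht
    have hM0 : 0 ≤ M := (abs_nonneg _).trans (hM t ht)
    have h := taylor_mean_remainder_bound (C := M) hpr.le hf.contDiffOn ht (fun y hy => by
      rw [iteratedDerivWithin_eq_iteratedDeriv (uniqueDiffOn_Icc hpr) (by exact_mod_cast hf.contDiffAt)
        hy]
      exact hM y hy)
    rw [taylor_within_apply, Real.norm_eq_abs] at h
    have he : (∑ j ∈ Finset.range (m + 1),
        C ((j.factorial : ℝ)⁻¹ * iteratedDerivWithin j f (Set.Icc p r) p) * (X - C p) ^ j).eval t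
        = ∑ j ∈ Finset.range (m + 1),
          ((j.factorial : ℝ)⁻¹ * (t - p) ^ j) • iteratedDerivWithin j f (Set.Icc p r) p := by
      rw [eval_finsetSum]
      refine Finset.sum_congr rfl fun j _ => ?_
      simp
      ring
    rw [he]
    refine h.trans ?_
    have h1 : (t - p) ^ (m + 1) ≤ (r - p) ^ (m + 1) :=
      pow_le_pow_left₀ (by linarith [ht.1]) (by linarith [ht.2]) _
    have h2 : (1 : ℝ) ≤ m.factorial := by exact_mod_cast Nat.one_le_iff_ne_zero.2 m.factorial_ne_zero
    calc M * (t - p) ^ (m + 1) / m.factorial ≤ M * (t - p) ^ (m + 1) :=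
          div_le_self (mul_nonneg hM0 (pow_nonneg (by linarith [ht.1]) _)) h2
      _ ≤ _ := mul_le_mul_of_nonneg_left h1 hM0

theorem affMap_mem_Ioo {p r s : ℝ} (hpr : p < r) (hs : s ∈ Set.Ioo (-1 : ℝ) 1) :
    affMap p r s ∈ Set.Ioo p r := by
  unfold affMap
  constructor <;> nlinarith [hs.1, hs.2]

open Polynomial in
/-- Bounds for integrals over an element of a residual that vanishes at the Gauss points. -/
theorem exists_element_residual_bound (n : ℕ) (hn : 1 ≤ n) (α β γ : ℝ) (hα : 0 < α) (hγ : 0 ≤ γ) :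
    ∃ K > 0, ∀ (p r : ℝ), p < r → ∀ (u u₁ u₂ : ℝ → ℝ), (∀ t, HasDerivAt u (u₁ t) t) →
      (∀ t, HasDerivAt u₁ (u₂ t) t) → ContDiff ℝ (n + 1) u₂ →
      ∀ W : ℝ[X], W.natDegree ≤ n + 1 → ∀ M B : ℝ,
      (∀ t ∈ Set.Icc p r, |iteratedDeriv n u₂ t| ≤ M) →
      (∀ t ∈ Set.Icc p r, |iteratedDeriv (n + 1) u₂ t| ≤ M) →
      (∀ t ∈ Set.Icc p r, |u t - W.eval t| ≤ B) →
      (∀ t ∈ Set.Icc p r, |u₁ t - (derivative W).eval t| ≤ B) →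
      ∀ g : ℝ → ℝ, (∀ t, g t = β * (u₁ t - (derivative W).eval t) + γ * (u t - W.eval t)
        - α * (u₂ t - (derivative (derivative W)).eval t)) →
      (∀ s ∈ Set.Ioo (-1 : ℝ) 1, legendre n s = 0 → g (affMap p r s) = 0) →
      (∀ t ∈ Set.Icc p r, |∫ y in p..t, g y| ≤ K * (r - p) * (B + M * (r - p) ^ n)) ∧
      |∫ y in p..r, g y| ≤ K * (r - p) ^ 2 * (B + M * (r - p) ^ n) := by
  obtain ⟨K, hK, hgauss⟩ := exists_gauss_bound n hn
  set A := |β| + γ with hA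
  have hA0 : 0 ≤ A := by positivity
  set K₁ := K * A / α + K + 1 with hK₁
  have hK₁0 : 0 < K₁ := by positivity
  set K₄ := |β| * K₁ + γ + α with hK₄
  have hK₄0 : 0 < K₄ := by positivity
  refine ⟨A + α * K₁ + (K + 1) * K₄, by positivity, ?_⟩
  intro p r hpr u u₁ u₂ hu hu₁ hu₂ W hW M B hM hM' hB hB' g hg hg0
  set H := r - p with hH
  have hH0 : 0 < H := by linarith
  have hp : p ∈ Set.Icc p r := ⟨le_rfl, hpr.le⟩
  have hM0 : 0 ≤ M := (abs_nonneg _).trans (hM p hp)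
  have hB0 : 0 ≤ B := (abs_nonneg _).trans (hB p hp)
  set E := B + M * H ^ n with hE
  have hMH0 : 0 ≤ M * H ^ n := by positivity
  have hBE : B ≤ E := by linarith
  have hME : M * H ^ n ≤ E := by linarith
  have hE0 : 0 ≤ E := by linarith
  have huc : Continuous u := continuous_iff_continuousAt.2 fun t => (hu t).continuousAt
  have hu₁c : Continuous u₁ := continuous_iff_continuousAt.2 fun t => (hu₁ t).continuousAt
  have hu₂c : Continuous u₂ := hu₂.continuous
  have hW'' : (derivative (derivative W)).natDegree ≤ n - 1 := by
    have h1 := natDegree_derivative_le (derivative W)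
    have h2 := natDegree_derivative_le W
    omega
  set φ : ℝ → ℝ := fun t => β * (u₁ t - (derivative W).eval t) + γ * (u t - W.eval t) with hφ
  have hgφ : ∀ t, g t = φ t - α * (u₂ t - (derivative (derivative W)).eval t) := hg
  have hφb : ∀ t ∈ Set.Icc p r, |φ t| ≤ A * B := by
    intro t ht
    calc |φ t| ≤ |β * (u₁ t - (derivative W).eval t)| + |γ * (u t - W.eval t)| := abs_add_le _ _
      _ ≤ |β| * B + γ * B := by
          rw [abs_mul, abs_mul, abs_of_nonneg hγ]
          gcongr
          · exact hB' t ht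
          · exact hB t ht
      _ = _ := by ring
  have hgc : Continuous g := by
    rw [funext hg]
    fun_prop
  have hgauss_mem : ∀ s ∈ Set.Ioo (-1 : ℝ) 1, affMap p r s ∈ Set.Icc p r := fun s hs =>
    Set.Ioo_subset_Icc_self (affMap_mem_Ioo hpr hs)
  -- the second derivative of the error
  have hv₂ : ∀ t ∈ Set.Icc p r, |u₂ t - (derivative (derivative W)).eval t| ≤ K₁ * E := by
    obtain ⟨T, hT, hTb⟩ := exists_polynomial_approx (f := u₂) (n - 1)
      (hu₂.of_le (by exact_mod_cast (by omega : n - 1 + 1 ≤ n + 1))) hpr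
      (M := M) (by rwa [Nat.sub_add_cancel hn])
    rw [Nat.sub_add_cancel hn] at hTb
    have hq := (hgauss p r hpr (T - derivative (derivative W)) (A * B / α + M * H ^ n)
      (by positivity) (fun s hs hs0 => by
        set y := affMap p r s
        have hy := hgauss_mem s hs
        have h0 : u₂ y - (derivative (derivative W)).eval y = φ y / α := by
          have := hg0 s hs hs0
          rw [hgφ] at this
          field_simp
          linarith
        have h1 : |φ y / α| ≤ A * B / α := by
          rw [abs_div, abs_of_pos hα]
          have := hφb y hy
          gcongr
        rw [eval_sub, show T.eval y - (derivative (derivative W)).eval y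
          = φ y / α - (u₂ y - T.eval y) by rw [← h0]; ring]
        exact (abs_sub _ _).trans (add_le_add h1 (hTb y hy)))).1
      ((natDegree_sub_le_of_le hT hW'').trans_lt (by rw [max_self]; omega))
    intro t ht
    have h1 := hq t ht
    rw [eval_sub] at h1
    calc |u₂ t - (derivative (derivative W)).eval t|
        = |(u₂ t - T.eval t) + (T.eval t - (derivative (derivative W)).eval t)| := by ring_nf
      _ ≤ M * H ^ n + K * (A * B / α + M * H ^ n) :=
          (abs_add_le _ _).trans (add_le_add (hTb t ht) h1)
      _ = (K * A / α) * B + (K + 1) * (M * H ^ n) := by ring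
      _ ≤ (K * A / α) * E + (K + 1) * E := by gcongr
      _ = K₁ * E := by rw [hK₁]; ring
  have hconst : ∀ (f : ℝ → ℝ) (D : ℝ), (∀ t ∈ Set.Icc p r, |f t| ≤ D) →
      ∀ t ∈ Set.Icc p r, |∫ y in p..t, f y| ≤ D * H := by
    intro f D hD t ht
    have hD0 : 0 ≤ D := (abs_nonneg _).trans (hD p hp)
    have := intervalIntegral.norm_integral_le_of_norm_le_const (a := p) (b := t) (f := f) (C := D)
      (fun s hs => by
        rw [Set.uIoc_of_le ht.1] at hs
        exact hD s ⟨hs.1.le, hs.2.trans ht.2⟩)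
    rw [Real.norm_eq_abs, abs_of_nonneg (by linarith [ht.1] : 0 ≤ t - p)] at this
    exact this.trans (mul_le_mul_of_nonneg_left (by linarith [ht.2]) hD0)
  constructor
  · intro t ht
    have hgb : ∀ t ∈ Set.Icc p r, |g t| ≤ (A + α * K₁) * E := by
      intro t ht
      rw [hgφ]
      calc _ ≤ |φ t| + |α * (u₂ t - (derivative (derivative W)).eval t)| := abs_sub _ _
        _ ≤ A * B + α * (K₁ * E) := by
            rw [abs_mul, abs_of_pos hα]
            have h1 := hφb t ht
            have h2 := hv₂ t ht
            gcongr
        _ ≤ A * E + α * (K₁ * E) := by gcongr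
        _ = _ := by ring
    refine (hconst g _ hgb t ht).trans ?_
    have : 0 ≤ (K + 1) * K₄ * H * E := by positivity
    linarith
  · have hφd : ∀ t, HasDerivAt φ (β * (u₂ t - (derivative (derivative W)).eval t)
        + γ * (u₁ t - (derivative W).eval t)) t := fun t =>
      (((hu₁ t).sub ((derivative W).hasDerivAt t)).const_mul β).add
        (((hu t).sub (W.hasDerivAt t)).const_mul γ)
    have hφl : ∀ t ∈ Set.Icc p r, |φ t - φ p| ≤ (|β| * K₁ + γ) * E * H := by
      intro t ht
      have := norm_image_sub_le_of_norm_deriv_le_segment' (f := φ) (a := p) (b := r)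
        (C := (|β| * K₁ + γ) * E) (fun x _ => (hφd x).hasDerivWithinAt) (fun x hx => by
          have hx' := Set.Ico_subset_Icc_self hx
          calc _ ≤ |β * (u₂ x - (derivative (derivative W)).eval x)|
                + |γ * (u₁ x - (derivative W).eval x)| := abs_add_le _ _
            _ ≤ |β| * (K₁ * E) + γ * E := by
                rw [abs_mul, abs_mul, abs_of_nonneg hγ]
                have h1 := hv₂ x hx'
                have h2 := (hB' x hx').trans hBE
                gcongr
            _ = _ := by ring) t ht
      refine this.trans ?_
      have : t - p ≤ H := by linarith [ht.2]
      gcongr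
    obtain ⟨T, hT, hTb⟩ := exists_polynomial_approx (f := u₂) n hu₂ hpr hM'
    set q := C (φ p) - C α * (T - derivative (derivative W)) with hq
    have hqe : ∀ t, q.eval t = φ p - α * (T.eval t - (derivative (derivative W)).eval t) := by
      intro t; simp [hq]
    have hqg : ∀ t ∈ Set.Icc p r, |g t - q.eval t| ≤ K₄ * E * H := by
      intro t ht
      rw [hgφ, hqe]
      calc _ = |(φ t - φ p) - α * (u₂ t - T.eval t)| := by ring_nf
        _ ≤ |φ t - φ p| + |α * (u₂ t - T.eval t)| := abs_sub _ _
        _ ≤ (|β| * K₁ + γ) * E * H + α * (M * H ^ (n + 1)) := by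
            rw [abs_mul, abs_of_pos hα]
            have h1 := hφl t ht
            have h2 := hTb t ht
            gcongr
        _ = (|β| * K₁ + γ) * E * H + α * (M * H ^ n) * H := by ring
        _ ≤ (|β| * K₁ + γ) * E * H + α * E * H := by gcongr
        _ = _ := by rw [hK₄]; ring
    have hqint := (hgauss p r hpr q (K₄ * E * H) (by positivity) (fun s hs hs0 => by
      have := hqg _ (hgauss_mem s hs)
      rwa [hg0 s hs hs0, zero_sub, abs_neg] at this)).2 (by
        refine (natDegree_sub_le_of_le (natDegree_C _).le
          ((natDegree_C_mul_le _ _).trans (natDegree_sub_le_of_le hT hW''))).trans ?_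
        simp)
    have hd := hconst (fun t => g t - q.eval t) _ hqg r ⟨hpr.le, le_rfl⟩
    rw [intervalIntegral.integral_sub (hgc.intervalIntegrable _ _)
      (q.continuous.intervalIntegrable _ _)] at hd
    have h1 : |∫ y in p..r, g y| ≤ K₄ * E * H * H + K * H * (K₄ * E * H) := by
      have := abs_add_le ((∫ y in p..r, g y) - ∫ y in p..r, q.eval y) (∫ y in p..r, q.eval y)
      rw [sub_add_cancel] at this
      linarith
    refine h1.trans ?_
    have : 0 ≤ (A + α * K₁) * H ^ 2 * E := by positivity
    linarith

theorem iteratedDeriv_iteratedDeriv_two (u : ℝ → ℝ) (j : ℕ) :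
    iteratedDeriv j (iteratedDeriv 2 u) = iteratedDeriv (j + 2) u := by
  simp only [iteratedDeriv_eq_iterate, Function.iterate_add_apply]

theorem abs_le_on_Icc_of_Ioo {f : ℝ → ℝ} {a b M : ℝ} (hf : Continuous f) (hab : a < b)
    (h : ∀ y ∈ Set.Ioo a b, |f y| ≤ M) : ∀ y ∈ Set.Icc a b, |f y| ≤ M := by
  intro y hy
  rw [← closure_Ioo hab.ne] at hy
  exact closure_minimal (t := {y | |f y| ≤ M}) h (isClosed_le hf.abs continuous_const) hy

theorem exists_mesh_element {x : ℕ → ℝ} {N : ℕ} (hN : 1 ≤ N) {t : ℝ}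
    (ht : t ∈ Set.Icc (x 0) (x N)) :
    ∃ i ∈ Finset.Icc 1 N, t ∈ Set.Icc (x (i - 1)) (x i) := by
  induction N, hN using Nat.le_induction with
  | base => exact ⟨1, by simp, ht⟩
  | succ N _ ih =>
    rcases le_total t (x N) with h | h
    · obtain ⟨i, hi, hti⟩ := ih ⟨ht.1, h⟩
      exact ⟨i, by rw [Finset.mem_Icc] at hi ⊢; omega, hti⟩
    · exact ⟨N + 1, by simp, by simpa using h, ht.2⟩

/-- Uniform bound for the primitive of the elementwise residual, obtained by summing the
element bounds over the mesh. -/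
theorem abs_flux_sub_le {N : ℕ} {x : ℕ → ℝ} {h K E : ℝ} (hN : 1 ≤ N)
    (hx : ∀ i < N, x i < x (i + 1)) (hh : ∀ i ∈ Finset.Icc 1 N, x i - x (i - 1) ≤ h)
    (hK : 0 ≤ K) (hE : 0 ≤ E) (F : ℝ → ℝ)
    (hF : ∀ i ∈ Finset.Icc 1 N, ∀ t ∈ Set.Icc (x (i - 1)) (x i),
      |F t - F (x (i - 1))| ≤ K * (x i - x (i - 1)) * E)
    (hF' : ∀ i ∈ Finset.Icc 1 N, |F (x i) - F (x (i - 1))| ≤ K * (x i - x (i - 1)) ^ 2 * E) :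
    ∀ t ∈ Set.Icc (x 0) (x N), |F t - F (x 0)| ≤ K * (x N - x 0 + 1) * (h * E) := by
  have hnode : ∀ i ≤ N, |F (x i) - F (x 0)| ≤ K * (x i - x 0) * (h * E) := by
    intro i
    induction i with
    | zero => simp
    | succ i ih =>
      intro hi
      have h1 := ih (by omega)
      have hmem : i + 1 ∈ Finset.Icc 1 N := by rw [Finset.mem_Icc]; omega
      have h2 := hF' (i + 1) hmem
      have h3 := hh (i + 1) hmem
      have h4 := hx i (by omega)
      simp only [Nat.add_sub_cancel] at h2 h3
      have h5 := abs_add_le (F (x (i + 1)) - F (x i)) (F (x i) - F (x 0))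
      rw [sub_add_sub_cancel] at h5
      have h6 : K * (x (i + 1) - x i) ^ 2 * E ≤ K * (x (i + 1) - x i) * (h * E) := by
        have : 0 ≤ K * (x (i + 1) - x i) * E := by
          have : 0 ≤ x (i + 1) - x i := by linarith
          positivity
        nlinarith
      linarith
  intro t ht
  obtain ⟨i, hi, hti⟩ := exists_mesh_element hN ht
  have hi' := Finset.mem_Icc.1 hi
  have h1 := hF i hi t hti
  have h2 := hnode (i - 1) (by omega)
  have h3 := mesh_monotone hx (show i - 1 ≤ N by omega) le_rfl
  have h0 := mesh_monotone hx (Nat.zero_le (i - 1)) (by omega)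
  have h4 := hh i hi
  have h5 := abs_add_le (F t - F (x (i - 1))) (F (x (i - 1)) - F (x 0))
  rw [sub_add_sub_cancel] at h5
  have hh0 : 0 ≤ h := by linarith [hti.1, hti.2]
  calc |F t - F (x 0)| ≤ K * (x i - x (i - 1)) * E + K * (x (i - 1) - x 0) * (h * E) := by linarith
    _ ≤ K * h * E + K * (x N - x 0) * (h * E) := by gcongr
    _ = _ := by ring

open Polynomial in
/-- Optimal-order `W^{1,∞}` estimate for Gauss collocation. -/
theorem exists_gauss_collocation_error_bound (k : ℕ) (hk : 3 ≤ k) (α β γ d : ℝ) (hα : 0 < α)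
    (hγ : 0 ≤ γ) (hd : 0 < d) :
    ∃ C > 0, ∃ h₀ > 0, ∀ (a b : ℝ), b - a = d → ∀ (N : ℕ) (x : ℕ → ℝ) (h : ℝ),
      IsMesh a b N x → IsMeshSize N x h → h ≤ h₀ →
      ∀ u : ℝ → ℝ, ContDiff ℝ (2 * k) u → u a = 0 → u b = 0 →
      ∀ P : ℕ → ℝ[X],
        IsGaussSol k N x α β γ (fun t => -α * iteratedDeriv 2 u t + β * deriv u t + γ * u t) P →
      ∀ M : ℝ, (∀ j ≤ 2 * k, ∀ y ∈ Set.Ioo a b, |iteratedDeriv j u y| ≤ M) →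
        ∀ i ∈ Finset.Icc 1 N, ∀ t ∈ Set.Icc (x (i - 1)) (x i),
          |u t - (P i).eval t| ≤ C * h ^ k * M ∧
            |deriv u t - (derivative (P i)).eval t| ≤ C * h ^ k * M := by
  obtain ⟨K, hK, hres⟩ := exists_element_residual_bound (k - 1) (by omega) α β γ hα hγ
  set K₂ := d / α + 2 / α * ((|β| + γ * d) * (d / α) + 1) with hK₂
  have hK₂0 : 0 < K₂ := by positivity
  set Q := K₂ * (K * (d + 1)) with hQ
  have hQ0 : 0 < Q := by positivity
  refine ⟨2 * Q, by positivity, 1 / (2 * Q), by positivity, ?_⟩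
  intro a b hab N x h hmesh hsize hh₀ u hu hua hub P hP M hM
  obtain ⟨hN, hx0, hxN, hx⟩ := hmesh
  obtain ⟨⟨hdeg, hmatch, hmatch', hPa, hPb⟩, hcol⟩ := hP
  have hlt : a < b := by linarith
  have hcd : ∀ j ≤ 2 * k, Continuous (iteratedDeriv j u) := fun j hj =>
    hu.continuous_iteratedDeriv j (by exact_mod_cast hj)
  have hMc : ∀ j ≤ 2 * k, ∀ y ∈ Set.Icc a b, |iteratedDeriv j u y| ≤ M := fun j hj =>
    abs_le_on_Icc_of_Ioo (hcd j hj) hlt (hM j hj)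
  have hM0 : 0 ≤ M := (abs_nonneg _).trans (hMc 0 (by omega) a ⟨le_rfl, hlt.le⟩)
  have hdiff : ∀ j < 2 * k, ∀ t, HasDerivAt (iteratedDeriv j u) (iteratedDeriv (j + 1) u t) t := by
    intro j hj t
    have := (hu.differentiable_iteratedDeriv j (by exact_mod_cast hj) t).hasDerivAt
    rwa [← iteratedDeriv_succ] at this
  have hu₁ : ∀ t, HasDerivAt u (deriv u t) t := by
    simpa using hdiff 0 (by omega)
  have hu₂ : ∀ t, HasDerivAt (deriv u) (iteratedDeriv 2 u t) t := by
    simpa using hdiff 1 (by omega)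
  have hu₂c : ContDiff ℝ ((k - 1 : ℕ) + 1) (iteratedDeriv 2 u) := by
    rw [iteratedDeriv_eq_iterate]
    have : ContDiff ℝ ((k : ℕ)) (deriv^[2] u) :=
      ContDiff.iterate_deriv' k 2 (hu.of_le (by exact_mod_cast (by omega : k + 2 ≤ 2 * k)))
    exact this.of_le (by exact_mod_cast (by omega : k - 1 + 1 ≤ k))
  have hsub : ∀ i ∈ Finset.Icc 1 N, Set.Icc (x (i - 1)) (x i) ⊆ Set.Icc a b := by
    intro i hi
    have hi' := Finset.mem_Icc.1 hi
    rw [← hx0, ← hxN]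
    exact Set.Icc_subset_Icc (mesh_monotone hx (Nat.zero_le _) (by omega))
      (mesh_monotone hx hi'.2 le_rfl)
  have hpos : ∀ i ∈ Finset.Icc 1 N, x (i - 1) < x i := by
    intro i hi
    have hi' := Finset.mem_Icc.1 hi
    have := hx (i - 1) (by omega)
    rwa [Nat.sub_add_cancel hi'.1] at this
  have h1mem : 1 ∈ Finset.Icc 1 N := by simp [hN]
  have hNmem : N ∈ Finset.Icc 1 N := by simp [hN]
  have hh0 : 0 ≤ h := by linarith [hsize.1 1 h1mem, hpos 1 h1mem]
  obtain ⟨v, v', hv, hv'c, hvf, -⟩ := exists_glued_of_matching x (fun i t => u t - (P i).eval t)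
    (fun i t => deriv u t - (derivative (P i)).eval t) N hN hx
    (fun i _ t => (hu₁ t).sub ((P i).hasDerivAt t))
    (fun i _ => (by simpa using hcd 1 (by omega) : Continuous (deriv u)).sub
      (derivative (P i)).continuous)
    (fun i hi => by simp only [hmatch i hi]) (fun i hi => by simp only [hmatch' i hi])
  have hvc : Continuous v := continuous_iff_continuousAt.2 fun t => (hv t).continuousAt
  have hva : v a = 0 := by
    rw [← hx0, (hvf 1 h1mem (x 0) ⟨le_rfl, (hpos 1 h1mem).le⟩).1, hPa, hx0, hua, sub_zero]
  have hvb : v b = 0 := by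
    rw [← hxN, (hvf N hNmem (x N) ⟨(hpos N hNmem).le, le_rfl⟩).1, hPb, hxN, hub, sub_zero]
  obtain ⟨s, hs, hsmax⟩ := isCompact_Icc.exists_isMaxOn (Set.nonempty_Icc.2 hlt.le)
    (f := fun t => max |v t| |v' t|) (hvc.abs.max hv'c.abs).continuousOn
  set B := max |v s| |v' s| with hB
  have hvB : ∀ t ∈ Set.Icc a b, |v t| ≤ B ∧ |v' t| ≤ B := fun t ht =>
    max_le_iff.1 (hsmax ht)
  have hB0 : 0 ≤ B := (abs_nonneg _).trans (le_max_left _ _)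
  set E := B + M * h ^ (k - 1) with hE
  have hE0 : 0 ≤ E := by positivity
  set F : ℝ → ℝ := fun t => β * v t + γ * (∫ y in a..t, v y) - α * v' t with hF
  have hFdiff : ∀ i ∈ Finset.Icc 1 N, ∀ t ∈ Set.Icc (x (i - 1)) (x i),
      F t - F (x (i - 1)) = ∫ y in x (i - 1)..t,
        (β * (deriv u y - (derivative (P i)).eval y) + γ * (u y - (P i).eval y)
          - α * (iteratedDeriv 2 u y - (derivative (derivative (P i))).eval y)) := by
    intro i hi t ht
    have hl : x (i - 1) ∈ Set.Icc (x (i - 1)) (x i) := ⟨le_rfl, (hpos i hi).le⟩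
    have hc₀ : Continuous u := by simpa using hcd 0 (by omega)
    have hc₁ : Continuous (deriv u) := by simpa using hcd 1 (by omega)
    have hc₂ : Continuous (iteratedDeriv 2 u) := hcd 2 (by omega)
    have hcu : Continuous fun y => u y - (P i).eval y := by fun_prop
    have hint : ∫ y in a..t, v y
        = (∫ y in a..x (i - 1), v y) + ∫ y in x (i - 1)..t, (u y - (P i).eval y) := by
      rw [← intervalIntegral.integral_add_adjacent_intervals
        (hvc.intervalIntegrable a (x (i - 1))) (hvc.intervalIntegrable (x (i - 1)) t)]
      congr 1
      refine intervalIntegral.integral_congr fun y hy => ?_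
      rw [Set.uIcc_of_le ht.1] at hy
      exact (hvf i hi y ⟨hy.1, hy.2.trans ht.2⟩).1
    have hprim := intervalIntegral.integral_eq_sub_of_hasDerivAt (a := x (i - 1)) (b := t)
      (fun y _ => (((hu₁ y).sub ((P i).hasDerivAt y)).const_mul β).sub
        (((hu₂ y).sub ((derivative (P i)).hasDerivAt y)).const_mul α))
      ((by fun_prop : Continuous _).intervalIntegrable _ _)
    have hsplit : ∫ y in x (i - 1)..t,
        (β * (deriv u y - (derivative (P i)).eval y) + γ * (u y - (P i).eval y)
          - α * (iteratedDeriv 2 u y - (derivative (derivative (P i))).eval y))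
        = (∫ y in x (i - 1)..t, (β * (deriv u y - (derivative (P i)).eval y)
          - α * (iteratedDeriv 2 u y - (derivative (derivative (P i))).eval y)))
          + γ * ∫ y in x (i - 1)..t, (u y - (P i).eval y) := by
      rw [← intervalIntegral.integral_const_mul, ← intervalIntegral.integral_add
        ((by fun_prop : Continuous _).intervalIntegrable _ _)
        ((hcu.const_mul γ).intervalIntegrable _ _)]
      refine intervalIntegral.integral_congr fun y _ => ?_
      ring
    rw [hsplit, hprim]
    simp only [hF, hint, (hvf i hi t ht).1, (hvf i hi t ht).2, (hvf i hi _ hl).1,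
      (hvf i hi _ hl).2, Pi.sub_apply]
    ring
  have helem : ∀ i ∈ Finset.Icc 1 N,
      (∀ t ∈ Set.Icc (x (i - 1)) (x i), |F t - F (x (i - 1))| ≤ K * (x i - x (i - 1)) * E) ∧
      |F (x i) - F (x (i - 1))| ≤ K * (x i - x (i - 1)) ^ 2 * E := by
    intro i hi
    have hr : x i ∈ Set.Icc (x (i - 1)) (x i) := ⟨(hpos i hi).le, le_rfl⟩
    obtain ⟨e₁, e₂⟩ := hres (x (i - 1)) (x i) (hpos i hi) u (deriv u) (iteratedDeriv 2 u) hu₁ hu₂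
      hu₂c (P i) ((hdeg i hi).trans (by omega)) M B
      (fun t ht => by
        rw [iteratedDeriv_iteratedDeriv_two]
        exact hMc _ (by omega) t (hsub i hi ht))
      (fun t ht => by
        rw [iteratedDeriv_iteratedDeriv_two]
        exact hMc _ (by omega) t (hsub i hi ht))
      (fun t ht => by
        have := (hvB t (hsub i hi ht)).1
        rwa [(hvf i hi t ht).1] at this)
      (fun t ht => by
        have := (hvB t (hsub i hi ht)).2
        rwa [(hvf i hi t ht).2] at this)
      _ (fun t => rfl) (fun s hs hs0 => by
        have := hcol i hi s hs hs0
        simp only at this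
        linarith)
    have hH0 : 0 < x i - x (i - 1) := by linarith [hpos i hi]
    have hEle : B + M * (x i - x (i - 1)) ^ (k - 1) ≤ E := by
      have := hsize.1 i hi
      rw [hE]
      gcongr
    refine ⟨fun t ht => ?_, ?_⟩
    · rw [hFdiff i hi t ht]
      exact (e₁ t ht).trans (by gcongr)
    · rw [hFdiff i hi _ hr]
      exact e₂.trans (by gcongr)
  have hflux := abs_flux_sub_le hN hx hsize.1 hK.le hE0 F (fun i hi => (helem i hi).1)
    (fun i hi => (helem i hi).2)
  rw [hx0, hxN, hab] at hflux
  have hstab := abs_le_of_flux_bound_nonneg hα hγ hlt (η := K * (d + 1) * (h * E))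
    (by positivity) hv hv'c hva hvb (fun t ht => by
      have := hflux t ht
      simpa [hF, hva] using this) s hs
  rw [hab] at hstab
  have hBQ : B ≤ Q * (h * E) := by
    have hη : 0 ≤ K * (d + 1) * (h * E) := by positivity
    have e₁ : 0 ≤ d / α * (K * (d + 1) * (h * E)) := by positivity
    have e₂ : 0 ≤ 2 / α * ((|β| + γ * d) * (d / α) + 1) * (K * (d + 1) * (h * E)) := by positivity
    have e₃ : Q * (h * E) = d / α * (K * (d + 1) * (h * E))
        + 2 / α * ((|β| + γ * d) * (d / α) + 1) * (K * (d + 1) * (h * E)) := by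
      rw [hQ, hK₂]; ring
    rw [e₃]
    exact max_le (by linarith [hstab.1]) (by linarith [hstab.2])
  have hBfin : B ≤ 2 * Q * h ^ k * M := by
    have hQh : Q * h ≤ 1 / 2 := by
      calc Q * h ≤ Q * (1 / (2 * Q)) := by gcongr
        _ = 1 / 2 := by field_simp
    have e₁ : Q * (h * E) = Q * h * B + Q * h ^ k * M := by
      obtain ⟨m, rfl⟩ : ∃ m, k = m + 1 := ⟨k - 1, by omega⟩
      rw [hE, Nat.add_sub_cancel]
      ring
    have e₂ : Q * h * B ≤ 1 / 2 * B := by gcongr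
    linarith
  intro i hi t ht
  have := hvB t (hsub i hi ht)
  rw [(hvf i hi t ht).1, (hvf i hi t ht).2] at this
  exact ⟨this.1.trans hBfin, this.2.trans hBfin⟩

/-- Superconvergence of the second derivative of the Gauss collocation solution at the Gauss
points (images of the roots of `L_{k-1}`), second derivatives of `ū_h` taken elementwise:
`|(u - ū_h)''(g_{in})| ≤ C h^k ‖u‖_{2k,∞}`. -/
theorem gauss_collocation_superconvergence_gauss_points (k : ℕ) (hk : 3 ≤ k)
    (α β γ c d : ℝ) (hα : 0 < α) (hγ : 0 ≤ γ) (hc : 1 ≤ c) (hd : 0 < d) :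
    ∃ C > 0, ∃ h₀ > 0, ∀ (a b : ℝ), b - a = d →
      ∀ (N : ℕ) (x : ℕ → ℝ) (h : ℝ),
        IsMesh a b N x → IsMeshSize N x h → IsQuasiUniform N x h c → h ≤ h₀ →
      ∀ u : ℝ → ℝ, ContDiff ℝ (2 * k) u → u a = 0 → u b = 0 →
      ∀ Pb : ℕ → Polynomial ℝ,
        IsGaussSol k N x α β γ (fun t => -α * iteratedDeriv 2 u t + β * deriv u t + γ * u t) Pb →
      ∀ M : ℝ, (∀ j ≤ 2 * k, ∀ y ∈ Set.Ioo a b, |iteratedDeriv j u y| ≤ M) →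
        ∀ i ∈ Finset.Icc 1 N, ∀ s ∈ Set.Ioo (-1 : ℝ) 1, legendre (k - 1) s = 0 →
          |iteratedDeriv 2 u (affMap (x (i - 1)) (x i) s)
              - (Polynomial.derivative (Polynomial.derivative (Pb i))).eval
                  (affMap (x (i - 1)) (x i) s)|
            ≤ C * h ^ k * M := by
  obtain ⟨C, hC, h₀, hh₀, hbound⟩ := exists_gauss_collocation_error_bound k hk α β γ d hα hγ hd
  refine ⟨(|β| + γ) / α * C + 1, by positivity, h₀, hh₀, ?_⟩
  intro a b hab N x h hmesh hsize _ hh u hu hua hub P hP M hM i hi s hs hs0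
  have hi' := Finset.mem_Icc.1 hi
  have hlt : x (i - 1) < x i := by
    have := hmesh.2.2.2 (i - 1) (by omega)
    rwa [Nat.sub_add_cancel hi'.1] at this
  have hb := hbound a b hab N x h hmesh hsize hh u hu hua hub P hP M hM i hi _
    (Set.Ioo_subset_Icc_self (affMap_mem_Ioo hlt hs))
  have hcol := hP.2 i hi s hs hs0
  set y := affMap (x (i - 1)) (x i) s
  have hM0 : 0 ≤ M := (abs_nonneg _).trans (hM 0 (by omega) ((a + b) / 2)
    ⟨by linarith, by linarith⟩)
  have hh0 : 0 ≤ h := by linarith [hsize.1 i hi]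
  have he : iteratedDeriv 2 u y - (Polynomial.derivative (Polynomial.derivative (P i))).eval y
      = (β * (deriv u y - (Polynomial.derivative (P i)).eval y)
        + γ * (u y - (P i).eval y)) / α := by
    field_simp
    linarith
  rw [he, abs_div, abs_of_pos hα]
  calc _ ≤ (|β| * (C * h ^ k * M) + γ * (C * h ^ k * M)) / α := by
        gcongr
        refine (abs_add_le _ _).trans ?_
        rw [abs_mul, abs_mul, abs_of_nonneg hγ]
        exact add_le_add (mul_le_mul_of_nonneg_left hb.2 (abs_nonneg _))
          (mul_le_mul_of_nonneg_left hb.1 hγ)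
    _ = (|β| + γ) / α * C * h ^ k * M := by ring
    _ ≤ _ := by
        have : 0 ≤ h ^ k * M := by positivity
        linarith
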